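/- arXiv:2503.02540 — 2 statements merged into one kernel-verified Lean document; each statement's English description precedes it below -/
import Mathlib

section
/- Let ω ∈ ℝᵈ satisfy the Diophantine condition with constants γ > 0 and τ > d−1, let ρ > 0, and let f : 𝕋ᵈ_{2ρ} → ℂⁿ be real analytic (real on real arguments) with Fourier expansion f(θ) = Σ_{k∈ℤᵈ} f_k e^{i⟨k,θ⟩} and average f₀. Then the function u(θ) = Σ_{k∈ℤᵈ∖{0}} f_k/(i⟨k,ω⟩) · e^{i⟨k,θ⟩} is well defined and real analytic on 𝕋ᵈ_ρ, satisfies (d/dt) u(ωt) = f(ωt) − f₀ for all t ∈ ℝ, and obeys the bound ‖u‖_ρ ≤ (1/γ) ‖f‖_{2ρ} ϖ(τ,ρ), where ϖ(τ,ρ) = Σ_{k∈ℤᵈ∖{0}} e^{−ρ|k|} |k|^τ. -/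
open Filter Set Topology

noncomputable section

/-- ℓ¹ norm `|k| = |k₁| + ⋯ + |k_d|` of an integer vector. -/
def knorm {d : ℕ} (k : Fin d → ℤ) : ℝ := ∑ i, |(k i : ℝ)|

/-- `⟨k, ω⟩ = k₁ω₁ + ⋯ + k_dω_d`. -/
def kdot {d : ℕ} (k : Fin d → ℤ) (ω : Fin d → ℝ) : ℝ := ∑ i, (k i : ℝ) * ω i

/-- The Diophantine condition `|⟨k,ω⟩| ≥ γ |k|^{-τ}` for all `k ∈ ℤᵈ \ {0}`. -/
def Diophantine {d : ℕ} (ω : Fin d → ℝ) (γ τ : ℝ) : Prop :=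
  ∀ k : Fin d → ℤ, k ≠ 0 → γ * knorm k ^ (-τ) ≤ |kdot k ω|

/-- The complex strip `𝕋ᵈ_ρ` (lifted to `ℂᵈ`): `|Im θᵢ| ≤ ρ` for all `i`. -/
def Strip (d : ℕ) (ρ : ℝ) : Set (Fin d → ℂ) := {θ | ∀ i, |(θ i).im| ≤ ρ}

/-- Periodicity with period `2π` in each (real) coordinate direction:
the function descends to (a strip around) the torus `ℂᵈ/2πℤᵈ`. -/
def CTorusPeriodic {d : ℕ} {E : Type*} (P : (Fin d → ℂ) → E) : Prop :=
  ∀ (θ : Fin d → ℂ) (m : Fin d → ℤ),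
    P (θ + fun i => ((2 * Real.pi * (m i : ℝ) : ℝ) : ℂ)) = P θ

/-- The function is real on real arguments. -/
def RealOnReal {d n : ℕ} (P : (Fin d → ℂ) → (Fin n → ℂ)) : Prop :=
  ∀ (θ : Fin d → ℝ) (j : Fin n), (P (fun i => (θ i : ℂ)) j).im = 0

/-- `ϖ(τ,ρ) = Σ_{k ≠ 0} e^{-ρ|k|} |k|^τ`. -/
def varpi (d : ℕ) (τ ρ : ℝ) : ℝ :=
  ∑' k : {k : Fin d → ℤ // k ≠ 0}, Real.exp (-ρ * knorm k.1) * knorm k.1 ^ τ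

/-- The exponential `e^{i⟨k,θ⟩}`. -/
def eK {d : ℕ} (k : Fin d → ℤ) (θ : Fin d → ℂ) : ℂ :=
  Complex.exp (Complex.I * ∑ i, (k i : ℂ) * θ i)

open scoped NNReal ENNReal
open MeasureTheory

section AnalyticSeries

variable {ι E F : Type*} [NormedAddCommGroup E] [NormedSpace ℂ E] [NormedAddCommGroup F]
  [NormedSpace ℂ F] [CompleteSpace F]

/-- A series of functions with power series at `x` whose coefficients are jointly absolutely
summable on a ball has a power series on that ball. -/
theorem hasFPowerSeriesOnBall_tsum {f : ι → E → F} {p : ι → FormalMultilinearSeries ℂ E F} {x : E}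
    {r : ℝ≥0} (hr : 0 < r)
    (hf : ∀ i y, HasSum (fun m : ℕ => p i m fun _ => y) (f i (x + y)))
    (hs : Summable fun q : ι × ℕ => ‖p q.1 q.2‖ * (r : ℝ) ^ q.2) :
    HasFPowerSeriesOnBall (fun y => ∑' i, f i y) (fun m => ∑' i, p i m) x r := by
  have hs' : Summable fun q : ℕ × ι => ‖p q.2 q.1‖ * (r : ℝ) ^ q.1 := hs.prod_symm
  have hr0 : (0 : ℝ) < r := hr
  have hnorm : ∀ m, Summable fun i => ‖p i m‖ := fun m => by
    have h := hs'.prod_factor m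
    exact (summable_mul_right_iff (pow_ne_zero m hr0.ne')).1 h
  refine ⟨?_, by exact_mod_cast hr, ?_⟩
  · refine FormalMultilinearSeries.le_radius_of_summable _ ?_
    have hsum : Summable fun m => ∑' i, ‖p i m‖ * (r : ℝ) ^ m := hs'.prod
    simp only [tsum_mul_right] at hsum
    refine Summable.of_nonneg_of_le (fun m => by positivity) (fun m => ?_) hsum
    exact mul_le_mul_of_nonneg_right (norm_tsum_le_tsum_norm (hnorm m)) (by positivity)
  · intro y hy
    have hyr : ‖y‖ ≤ r := by
      have : ‖y‖ < r := by simpa using hy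
      exact this.le
    have ha : Summable fun q : ι × ℕ => p q.1 q.2 fun _ => y := by
      refine Summable.of_norm_bounded hs (fun q => ?_)
      refine ((p q.1 q.2).le_opNorm _).trans ?_
      simp only [Finset.prod_const, Finset.card_univ, Fintype.card_fin]
      gcongr
    have h1 := ha.hasSum.prod_fiberwise (fun i => hf i y)
    have h2 : HasSum (fun m : ℕ => ∑' i, p i m fun _ => y)
        (∑' q : ι × ℕ, p q.1 q.2 fun _ => y) := by
      have h := ((Equiv.prodComm ℕ ι).hasSum_iff.2 ha.hasSum)
      exact h.prod_fiberwise fun m => (h.summable.prod_factor m).hasSum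
    rw [h1.tsum_eq]
    convert h2 using 2 with m
    exact ContinuousMultilinearMap.tsum_eval (hnorm m).of_norm _

/-- An absolutely convergent series of exponentials of linear forms is analytic at the origin. -/
theorem analyticAt_tsum_mul_exp {b : ι → ℂ} {ℓ : ι → E →L[ℂ] ℂ} {r : ℝ} (hr : 0 < r)
    (hs : Summable fun i => ‖b i‖ * Real.exp (r * ‖ℓ i‖)) :
    AnalyticAt ℂ (fun h => ∑' i, b i * Complex.exp (ℓ i h)) 0 := by
  lift r to ℝ≥0 using hr.le
  let p : ι → FormalMultilinearSeries ℂ E ℂ := fun i m =>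
    b i • (NormedSpace.expSeries ℂ ℂ).compContinuousLinearMap (ℓ i) m
  have hp : ∀ i m, ‖p i m‖ * (r : ℝ) ^ m ≤ ‖b i‖ * ((r * ‖ℓ i‖) ^ m / (m.factorial : ℝ)) := by
    intro i m
    have h1 : ‖NormedSpace.expSeries ℂ ℂ m‖ ≤ (m.factorial : ℝ)⁻¹ := by
      rw [NormedSpace.expSeries, norm_smul]
      simp
    have h2 := (NormedSpace.expSeries ℂ ℂ).norm_compContinuousLinearMap_le (ℓ i) m
    calc ‖p i m‖ * (r : ℝ) ^ m
        = ‖b i‖ * ‖(NormedSpace.expSeries ℂ ℂ).compContinuousLinearMap (ℓ i) m‖ * r ^ m := by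
          rw [norm_smul]
      _ ≤ ‖b i‖ * ((m.factorial : ℝ)⁻¹ * ‖ℓ i‖ ^ m) * r ^ m := by
          gcongr
          exact h2.trans (by gcongr)
      _ = _ := by rw [mul_pow]; ring
  have hexp : ∀ x : ℝ, HasSum (fun m : ℕ => x ^ m / (m.factorial : ℝ)) (Real.exp x) := fun x => by
    rw [Real.exp_eq_exp_ℝ]
    exact NormedSpace.expSeries_div_hasSum_exp x
  refine HasFPowerSeriesAt.analyticAt (p := fun m => ∑' i, p i m)
    (HasFPowerSeriesOnBall.hasFPowerSeriesAt (r := r)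
      (hasFPowerSeriesOnBall_tsum (p := p) (by exact_mod_cast hr) (fun i y => ?_) ?_))
  · rw [zero_add]
    have h : HasSum (fun m : ℕ => (ℓ i y) ^ m / (m.factorial : ℂ)) (Complex.exp (ℓ i y)) := by
      rw [Complex.exp_eq_exp_ℂ]
      exact NormedSpace.expSeries_div_hasSum_exp _
    refine (h.mul_left (b i)).congr_fun fun m => ?_
    exact congrArg (b i * ·) (NormedSpace.expSeries_apply_eq_div (𝕂 := ℂ) (ℓ i y) m)
  · have h : Summable fun q : ι × ℕ =>
        ‖b q.1‖ * ((r * ‖ℓ q.1‖) ^ q.2 / (q.2.factorial : ℝ)) := by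
      refine (summable_prod_of_nonneg fun q => by positivity).2
        ⟨fun i => ((hexp (r * ‖ℓ i‖)).mul_left ‖b i‖).summable, ?_⟩
      exact hs.congr fun i => ((hexp (r * ‖ℓ i‖)).mul_left ‖b i‖).tsum_eq.symm
    exact Summable.of_nonneg_of_le (fun q => by positivity) (fun q => hp q.1 q.2) h

end AnalyticSeries

section Exponentials

variable {d : ℕ}

theorem knorm_nonneg (k : Fin d → ℤ) : 0 ≤ knorm k :=
  Finset.sum_nonneg fun _ _ => abs_nonneg _

theorem knorm_pos {k : Fin d → ℤ} (hk : k ≠ 0) : 0 < knorm k := by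
  obtain ⟨i, hi⟩ := Function.ne_iff.1 hk
  refine Finset.sum_pos' (fun _ _ => abs_nonneg _) ⟨i, Finset.mem_univ i, ?_⟩
  exact abs_pos.2 (by exact_mod_cast hi)

theorem norm_eK (k : Fin d → ℤ) (θ : Fin d → ℂ) :
    ‖eK k θ‖ = Real.exp (-∑ i, (k i : ℝ) * (θ i).im) := by
  rw [eK, Complex.norm_exp]
  congr 1
  simp

theorem norm_eK_le {R : ℝ} (k : Fin d → ℤ) {θ : Fin d → ℂ} (hθ : θ ∈ Strip d R) :
    ‖eK k θ‖ ≤ Real.exp (R * knorm k) := by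
  rw [norm_eK, Real.exp_le_exp, ← Finset.sum_neg_distrib, knorm, Finset.mul_sum]
  refine Finset.sum_le_sum fun i _ => ?_
  calc -((k i : ℝ) * (θ i).im) ≤ |(k i : ℝ) * (θ i).im| := neg_le_abs _
    _ = |(θ i).im| * |(k i : ℝ)| := by rw [abs_mul, mul_comm]
    _ ≤ R * |(k i : ℝ)| := by gcongr; exact hθ i

/-- The bound in `norm_eK_le` is attained at a corner of the strip. -/
theorem norm_eK_neg_sign (R : ℝ) (k : Fin d → ℤ) :
    ‖eK k fun i => Complex.I * ((-(R * (SignType.sign (k i : ℝ) : ℝ)) : ℝ) : ℂ)‖ =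
      Real.exp (R * knorm k) := by
  rw [norm_eK, ← Finset.sum_neg_distrib, knorm, Finset.mul_sum]
  congr 1
  refine Finset.sum_congr rfl fun i _ => ?_
  have h : (k i : ℝ) * (SignType.sign (k i : ℝ) : ℝ) = |(k i : ℝ)| := self_mul_sign _
  simp only [Complex.I_mul_im, Complex.ofReal_re]
  rw [← h]
  ring

theorem eK_add (k : Fin d → ℤ) (θ η : Fin d → ℂ) : eK k (θ + η) = eK k θ * eK k η := by
  simp only [eK, ← Complex.exp_add, Pi.add_apply, mul_add, Finset.sum_add_distrib]

theorem eK_add_two_pi (k : Fin d → ℤ) (θ : Fin d → ℂ) (m : Fin d → ℤ) :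
    eK k (θ + fun i => ((2 * Real.pi * (m i : ℝ) : ℝ) : ℂ)) = eK k θ := by
  have h : eK k (fun i => ((2 * Real.pi * (m i : ℝ) : ℝ) : ℂ)) = 1 := by
    rw [eK, Complex.exp_eq_one_iff]
    refine ⟨∑ i, k i * m i, ?_⟩
    push_cast
    rw [Finset.mul_sum, Finset.sum_mul]
    exact Finset.sum_congr rfl fun i _ => by ring
  rw [eK_add, h, mul_one]

theorem conj_eK_ofReal (k : Fin d → ℤ) (x : Fin d → ℝ) :
    (starRingEnd ℂ) (eK k fun i => (x i : ℂ)) = eK (-k) fun i => (x i : ℂ) := by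
  rw [eK, eK, ← Complex.exp_conj]
  congr 1
  simp

theorem eK_flow (k : Fin d → ℤ) (ω : Fin d → ℝ) (s : ℝ) :
    eK k (fun i => ((s * ω i : ℝ) : ℂ)) = Complex.exp (Complex.I * (kdot k ω : ℝ) * s) := by
  rw [eK, kdot]
  congr 1
  push_cast
  rw [mul_assoc, Finset.sum_mul]
  congr 1
  exact Finset.sum_congr rfl fun i _ => by ring

theorem ofReal_mem_strip {R : ℝ} (hR : 0 ≤ R) (x : Fin d → ℝ) :
    (fun i => (x i : ℂ)) ∈ Strip d R := fun i => by simpa using hR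

/-- The linear form `θ ↦ i⟨k,θ⟩`. -/
def phaseForm (k : Fin d → ℤ) : (Fin d → ℂ) →L[ℂ] ℂ :=
  Complex.I • ∑ i, (k i : ℂ) • ContinuousLinearMap.proj (R := ℂ) (φ := fun _ : Fin d => ℂ) i

theorem exp_phaseForm (k : Fin d → ℤ) (θ : Fin d → ℂ) : Complex.exp (phaseForm k θ) = eK k θ := by
  simp [phaseForm, eK, sum_apply]

theorem norm_phaseForm_le (k : Fin d → ℤ) : ‖phaseForm k‖ ≤ knorm k := by
  refine ContinuousLinearMap.opNorm_le_bound _ (knorm_nonneg k) fun θ => ?_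
  have h : phaseForm k θ = Complex.I * ∑ i, (k i : ℂ) * θ i := by
    simp [phaseForm, sum_apply]
  rw [h, norm_mul, Complex.norm_I, one_mul, knorm, Finset.sum_mul]
  refine (norm_sum_le _ _).trans (Finset.sum_le_sum fun i _ => ?_)
  rw [norm_mul, Complex.norm_intCast]
  gcongr
  exact norm_le_pi_norm θ i

/-- A Fourier series with exponentially decaying coefficients is analytic on a smaller strip. -/
theorem analyticOnNhd_tsum_mul_eK {a : (Fin d → ℤ) → ℂ} {R S : ℝ} (hRS : R < S)
    (ha : Summable fun k => ‖a k‖ * Real.exp (S * knorm k)) :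
    AnalyticOnNhd ℂ (fun θ => ∑' k, a k * eK k θ) (Strip d R) := by
  intro θ₀ hθ₀
  have h0 : AnalyticAt ℂ (fun h => ∑' k, a k * eK k θ₀ * Complex.exp (phaseForm k h)) 0 := by
    refine analyticAt_tsum_mul_exp (sub_pos.2 hRS) ?_
    refine Summable.of_nonneg_of_le (fun k => by positivity) (fun k => ?_) ha
    rw [norm_mul, mul_assoc]
    gcongr
    calc ‖eK k θ₀‖ * Real.exp ((S - R) * ‖phaseForm k‖)
        ≤ Real.exp (R * knorm k) * Real.exp ((S - R) * knorm k) := by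
          refine mul_le_mul (norm_eK_le k hθ₀) (Real.exp_le_exp.2 ?_) (Real.exp_pos _).le
            (Real.exp_pos _).le
          exact mul_le_mul_of_nonneg_left (norm_phaseForm_le k) (sub_pos.2 hRS).le
      _ = Real.exp (S * knorm k) := by rw [← Real.exp_add]; ring_nf
  have h1 : AnalyticAt ℂ (fun θ : Fin d → ℂ => θ - θ₀) θ₀ := analyticAt_id.sub analyticAt_const
  have h2 := AnalyticAt.fun_comp_of_eq (g := fun h => ∑' k, a k * eK k θ₀ * Complex.exp (phaseForm k h))
    h0 h1 (sub_self θ₀)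
  convert h2 using 4 with θ k
  rw [exp_phaseForm, mul_assoc, ← eK_add, add_sub_cancel]

end Exponentials

section Coefficients

variable {d : ℕ}

local instance unitAddCircleMeasureSpace : MeasureSpace UnitAddCircle := ⟨AddCircle.haarAddCircle⟩

local instance unitAddCircleIsProbabilityMeasure :
    IsProbabilityMeasure (volume : Measure UnitAddCircle) :=
  inferInstanceAs (IsProbabilityMeasure AddCircle.haarAddCircle)

theorem mFourier_coe (k : Fin d → ℤ) (t : Fin d → ℝ) :
    UnitAddTorus.mFourier k (fun i => (t i : UnitAddCircle)) =
      eK k fun i => ((2 * Real.pi * t i : ℝ) : ℂ) := by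
  simp only [UnitAddTorus.mFourier, ContinuousMap.coe_mk, fourier_coe_apply, ← Complex.exp_sum, eK,
    Finset.mul_sum]
  congr 1
  refine Finset.sum_congr rfl fun i _ => ?_
  push_cast
  ring

/-- The coefficients of an absolutely convergent Fourier series are bounded by the sup norm of its
sum on the real torus. -/
theorem norm_coeff_le_of_norm_tsum_le {c : (Fin d → ℤ) → ℂ} (hc : Summable fun k => ‖c k‖) {M : ℝ}
    (hM : ∀ x : Fin d → ℝ, ‖∑' k, c k * eK k fun i => (x i : ℂ)‖ ≤ M) (k : Fin d → ℤ) :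
    ‖c k‖ ≤ M := by
  have hM0 : 0 ≤ M := (norm_nonneg _).trans (hM 0)
  have hsum : Summable fun k => c k • UnitAddTorus.mFourier k := by
    refine Summable.of_norm ?_
    simpa only [norm_smul, UnitAddTorus.mFourier_norm, mul_one] using hc
  obtain ⟨g, hg⟩ := hsum
  have hgM : ‖g‖ ≤ M := by
    refine (ContinuousMap.norm_le _ hM0).2 fun x => ?_
    obtain ⟨t, rfl⟩ : ∃ t : Fin d → ℝ, (fun i => (t i : UnitAddCircle)) = x :=
      ⟨fun i => (QuotientAddGroup.mk_surjective (x i)).choose,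
        funext fun i => (QuotientAddGroup.mk_surjective (x i)).choose_spec⟩
    have h := (ContinuousMap.hasSum_apply hg fun i => (t i : UnitAddCircle)).tsum_eq
    simp only [ContinuousMap.smul_apply, smul_eq_mul, mFourier_coe] at h
    rw [← h]
    exact hM _
  let T := ContinuousMap.toLp (E := ℂ) 2 (volume : Measure (UnitAddTorus (Fin d))) ℂ
  have hT : HasSum (fun k' => c k' • UnitAddTorus.mFourierLp 2 k') (T g) := by
    simpa only [Function.comp_def, map_smul] using hg.mapL T
  have horth := orthonormal_iff_ite.1 (UnitAddTorus.orthonormal_mFourier (d := Fin d))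
  have hinner : inner ℂ (UnitAddTorus.mFourierLp 2 k) (T g) = c k := by
    have h := hT.mapL (innerSL ℂ (UnitAddTorus.mFourierLp 2 k))
    simp only [innerSL_apply_apply, inner_smul_right, horth, mul_ite, mul_one, mul_zero] at h
    simpa using h.unique (hasSum_single k fun k' hk' => if_neg hk'.symm)
  have hnorm : ‖UnitAddTorus.mFourierLp (d := Fin d) 2 k‖ = 1 :=
    (UnitAddTorus.orthonormal_mFourier (d := Fin d)).1 k
  have hTn : ‖T‖ ≤ 1 := by
    simpa [measureUnivNNReal] using
      ContinuousMap.toLp_norm_le (p := 2) (μ := (volume : Measure (UnitAddTorus (Fin d))))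
        (E := ℂ) (𝕜 := ℂ)
  calc ‖c k‖ = ‖inner ℂ (UnitAddTorus.mFourierLp 2 k) (T g)‖ := by rw [hinner]
    _ ≤ ‖UnitAddTorus.mFourierLp 2 k‖ * ‖T g‖ := norm_inner_le_norm _ _
    _ = ‖T g‖ := by rw [hnorm, one_mul]
    _ ≤ ‖T‖ * ‖g‖ := T.le_opNorm g
    _ ≤ 1 * M := by gcongr
    _ = M := one_mul M

/-- Pointwise unconditional convergence of a Fourier series on a closed strip forces absolute
convergence, uniformly on the strip. -/
theorem summable_norm_mul_exp_of_summable {c : (Fin d → ℤ) → ℂ} {R : ℝ} (hR : 0 ≤ R)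
    (hc : ∀ θ ∈ Strip d R, Summable fun k => c k * eK k θ) :
    Summable fun k => ‖c k‖ * Real.exp (R * knorm k) := by
  let y : (Fin d → SignType) → Fin d → ℂ := fun s i => Complex.I * ((-(R * (s i : ℝ)) : ℝ) : ℂ)
  have hy : ∀ s, y s ∈ Strip d R := fun s i => by
    rcases h : s i <;> simp [y, h, abs_of_nonneg hR, hR]
  have hsum : Summable fun k => ∑ s, ‖c k * eK k (y s)‖ :=
    summable_sum fun s _ => (hc _ (hy s)).norm
  refine Summable.of_nonneg_of_le (fun k => by positivity) (fun k => ?_) hsum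
  refine le_trans (le_of_eq ?_) (Finset.single_le_sum (f := fun s => ‖c k * eK k (y s)‖)
    (fun s _ => norm_nonneg _) (Finset.mem_univ fun i => SignType.sign (k i : ℝ)))
  rw [norm_mul, norm_eK_neg_sign]

/-- Cauchy estimate: Fourier coefficients decay exponentially in terms of the sup norm on a
strip. -/
theorem norm_coeff_mul_exp_le {c : (Fin d → ℤ) → ℂ} {R M : ℝ} (hR : 0 ≤ R)
    {g : (Fin d → ℂ) → ℂ} (hg : ∀ θ ∈ Strip d R, HasSum (fun k => c k * eK k θ) (g θ))
    (hM : ∀ θ ∈ Strip d R, ‖g θ‖ ≤ M) (k : Fin d → ℤ) :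
    ‖c k‖ * Real.exp (R * knorm k) ≤ M := by
  let y : Fin d → ℂ := fun i => Complex.I * ((-(R * (SignType.sign (k i : ℝ) : ℝ)) : ℝ) : ℂ)
  have hy : ∀ x : Fin d → ℝ, y + (fun i => (x i : ℂ)) ∈ Strip d R := fun x i => by
    simp only [y, Pi.add_apply, Complex.add_im, Complex.I_mul_im, Complex.ofReal_re,
      Complex.ofReal_im, add_zero]
    rcases SignType.sign (k i : ℝ) <;> simp [abs_of_nonneg hR, hR]
  have hy0 : y ∈ Strip d R := by
    have h := hy 0
    have h' : y + (fun i => (((0 : Fin d → ℝ) i : ℝ) : ℂ)) = y := by ext i; simp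
    rwa [h'] at h
  have key := norm_coeff_le_of_norm_tsum_le (c := fun k => c k * eK k y) (hg y hy0).summable.norm
    (M := M) (fun x => by
      simp only [mul_assoc, ← eK_add]
      rw [(hg _ (hy x)).tsum_eq]
      exact hM _ (hy x)) k
  refine le_trans (le_of_eq ?_) key
  rw [norm_mul, norm_eK_neg_sign]

/-- The Fourier coefficients of a function that is real on the real torus are Hermitian. -/
theorem conj_coeff_of_im_eq_zero {c : (Fin d → ℤ) → ℂ} (hc : Summable fun k => ‖c k‖)
    (hreal : ∀ x : Fin d → ℝ, (∑' k, c k * eK k fun i => (x i : ℂ)).im = 0) (k : Fin d → ℤ) :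
    (starRingEnd ℂ) (c (-k)) = c k := by
  have hc' : Summable fun k => ‖c (-k)‖ := (Equiv.neg (Fin d → ℤ)).summable_iff.2 hc
  have hnorm : ∀ (x : Fin d → ℝ) k, ‖eK k fun i => (x i : ℂ)‖ = 1 := fun x k => by
    rw [norm_eK]; simp
  have hs : ∀ x : Fin d → ℝ, Summable fun k => c k * eK k fun i => (x i : ℂ) := fun x =>
    Summable.of_norm (by simpa only [norm_mul, hnorm, mul_one] using hc)
  have hconj : ∀ x : Fin d → ℝ, HasSum
      (fun k => (starRingEnd ℂ) (c (-k)) * eK k fun i => (x i : ℂ))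
      (∑' k, c k * eK k fun i => (x i : ℂ)) := fun x => by
    have h1 := (hs x).hasSum.map (starRingEnd ℂ) Complex.continuous_conj
    rw [Complex.conj_eq_iff_im.2 (hreal x)] at h1
    have h2 := (Equiv.neg (Fin d → ℤ)).hasSum_iff.2 h1
    refine h2.congr_fun ?_
    intro k
    simp [conj_eK_ofReal]
  have h := norm_coeff_le_of_norm_tsum_le (c := fun k => (starRingEnd ℂ) (c (-k)) - c k) (M := 0)
    (Summable.of_nonneg_of_le (fun _ => norm_nonneg _)
      (fun k => (norm_sub_le _ _).trans (by rw [RCLike.norm_conj])) (hc'.add hc))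
    (fun x => by
      have h := ((hconj x).sub (hs x).hasSum).tsum_eq
      rw [sub_self] at h
      simp only [sub_mul]
      rw [h, norm_zero]) k
  exact sub_eq_zero.1 (norm_le_zero_iff.1 h)

end Coefficients

section Summability

theorem rpow_le_mul_exp {τ ε x : ℝ} (hτ : 0 < τ) (hε : 0 < ε) (hx : 0 ≤ x) :
    x ^ τ ≤ (τ / ε) ^ τ * Real.exp (ε * x) := by
  have h1 : ε * x / τ ≤ Real.exp (ε * x / τ) := by linarith [Real.add_one_le_exp (ε * x / τ)]
  calc x ^ τ = (τ / ε * (ε * x / τ)) ^ τ := by congr 1; field_simp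
    _ = (τ / ε) ^ τ * (ε * x / τ) ^ τ := Real.mul_rpow (by positivity) (by positivity)
    _ ≤ (τ / ε) ^ τ * Real.exp (ε * x / τ) ^ τ := by gcongr
    _ = (τ / ε) ^ τ * Real.exp (ε * x) := by
      rw [← Real.exp_mul]; congr 2; field_simp

theorem summable_pi_prod {g : ℤ → ℝ} (hg : Summable g) (hg0 : ∀ x, 0 ≤ g x) (d : ℕ) :
    Summable fun k : Fin d → ℤ => ∏ i, g (k i) := by
  induction d with
  | zero => exact Summable.of_finite
  | succ d ih =>
    rw [← (Fin.consEquiv fun _ : Fin (d + 1) => ℤ).summable_iff]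
    have h := hg.mul_of_nonneg ih hg0 fun k => Finset.prod_nonneg fun i _ => hg0 _
    convert h using 2 with q
    simp [Fin.prod_univ_succ, Fin.consEquiv]

theorem summable_exp_neg_mul_abs {ε : ℝ} (hε : 0 < ε) :
    Summable fun m : ℤ => Real.exp (-ε * |(m : ℝ)|) := by
  have h : Summable fun m : ℕ => Real.exp (-ε * m) := by
    simpa only [mul_comm] using Real.summable_exp_nat_mul_iff.2 (neg_lt_zero.2 hε)
  refine Summable.of_nat_of_neg ?_ ?_ <;> simpa using h

theorem summable_exp_neg_mul_knorm {ε : ℝ} (hε : 0 < ε) (d : ℕ) :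
    Summable fun k : Fin d → ℤ => Real.exp (-ε * knorm k) := by
  convert summable_pi_prod (summable_exp_neg_mul_abs hε) (fun _ => (Real.exp_pos _).le) d using 2
    with k
  rw [knorm, Finset.mul_sum, Real.exp_sum]

theorem summable_exp_mul_knorm_rpow {τ ρ : ℝ} (hτ : 0 < τ) (hρ : 0 < ρ) (d : ℕ) :
    Summable fun k : Fin d → ℤ => Real.exp (-ρ * knorm k) * knorm k ^ τ := by
  refine Summable.of_nonneg_of_le
    (fun k => mul_nonneg (Real.exp_pos _).le (Real.rpow_nonneg (knorm_nonneg k) _)) (fun k => ?_)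
    ((summable_exp_neg_mul_knorm (half_pos hρ) d).mul_left ((τ / (ρ / 2)) ^ τ))
  calc Real.exp (-ρ * knorm k) * knorm k ^ τ
      ≤ Real.exp (-ρ * knorm k) * ((τ / (ρ / 2)) ^ τ * Real.exp (ρ / 2 * knorm k)) := by
        gcongr
        exact rpow_le_mul_exp hτ (half_pos hρ) (knorm_nonneg k)
    _ = (τ / (ρ / 2)) ^ τ * (Real.exp (-ρ * knorm k) * Real.exp (ρ / 2 * knorm k)) := by ring
    _ = (τ / (ρ / 2)) ^ τ * Real.exp (-(ρ / 2) * knorm k) := by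
        rw [← Real.exp_add]; ring_nf

end Summability

section SmallDivisors

variable {d : ℕ} {ω : Fin d → ℝ} {γ τ : ℝ}

theorem Diophantine.kdot_ne_zero (h : Diophantine ω γ τ) (hγ : 0 < γ) {k : Fin d → ℤ}
    (hk : k ≠ 0) : kdot k ω ≠ 0 := by
  have := h k hk
  have hpos : 0 < γ * knorm k ^ (-τ) := mul_pos hγ (Real.rpow_pos_of_pos (knorm_pos hk) _)
  exact abs_pos.1 (hpos.trans_le this)

theorem kdot_zero (ω : Fin d → ℝ) : kdot 0 ω = 0 := by simp [kdot]

theorem kdot_neg (k : Fin d → ℤ) (ω : Fin d → ℝ) : kdot (-k) ω = -kdot k ω := by simp [kdot]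

theorem Diophantine.norm_div_le (h : Diophantine ω γ τ) (hγ : 0 < γ) (k : Fin d → ℤ) (z : ℂ) :
    ‖z / (Complex.I * (kdot k ω : ℝ))‖ ≤ γ⁻¹ * knorm k ^ τ * ‖z‖ := by
  have h0 : 0 ≤ knorm k ^ τ := Real.rpow_nonneg (knorm_nonneg k) _
  rcases eq_or_ne k 0 with rfl | hk
  · rw [kdot_zero, Complex.ofReal_zero, mul_zero, div_zero, norm_zero]
    positivity
  · have h1 := h k hk
    have hpos : 0 < knorm k ^ τ := Real.rpow_pos_of_pos (knorm_pos hk) _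
    rw [Real.rpow_neg (knorm_nonneg k)] at h1
    rw [norm_div, norm_mul, Complex.norm_I, one_mul, Complex.norm_real, Real.norm_eq_abs,
      div_eq_inv_mul]
    gcongr
    calc |kdot k ω|⁻¹ ≤ (γ * (knorm k ^ τ)⁻¹)⁻¹ := by gcongr
      _ = γ⁻¹ * knorm k ^ τ := by rw [mul_inv, inv_inv]

end SmallDivisors

/-- Solution of the small-divisor equation `∂u/∂t = f(ωt) - f₀`:
`u(θ) = Σ_{k≠0} f_k/(i⟨k,ω⟩) e^{i⟨k,θ⟩}` is well defined and real analytic on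
`𝕋ᵈ_ρ`, solves the equation along the flow, and `‖u‖_ρ ≤ γ⁻¹ ‖f‖_{2ρ} ϖ(τ,ρ)`. -/
theorem small_divisor_primitive
    (n d : ℕ) (hn : 0 < n) (hd : 0 < d)
    (ω : Fin d → ℝ) (γ τ : ℝ) (hγ : 0 < γ) (hτ : (d : ℝ) - 1 < τ)
    (hdio : Diophantine ω γ τ)
    (ρ : ℝ) (hρ : 0 < ρ)
    (f : (Fin d → ℂ) → (Fin n → ℂ))
    (hfper : CTorusPeriodic f)
    (hfan : AnalyticOnNhd ℂ f (Strip d (2 * ρ)))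
    (hfreal : RealOnReal f)
    -- Fourier expansion of `f` with coefficients `f_k` and average `f₀ = fk 0`
    (fk : (Fin d → ℤ) → (Fin n → ℂ))
    (hfk : ∀ θ ∈ Strip d (2 * ρ), ∀ j,
      HasSum (fun k : Fin d → ℤ => fk k j * eK k θ) (f θ j)) :
    ∃ u : (Fin d → ℂ) → (Fin n → ℂ),
      -- `u` is given by the convergent series `Σ_{k≠0} f_k/(i⟨k,ω⟩) e^{i⟨k,θ⟩}`
      (∀ θ ∈ Strip d ρ, ∀ j,
        HasSum (fun k : {k : Fin d → ℤ // k ≠ 0} =>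
          fk k.1 j / (Complex.I * (kdot k.1 ω : ℝ)) * eK k.1 θ) (u θ j)) ∧
      CTorusPeriodic u ∧
      AnalyticOnNhd ℂ u (Strip d ρ) ∧
      RealOnReal u ∧
      -- `(d/dt) u(ωt) = f(ωt) - f₀`
      (∀ t : ℝ, HasDerivAt (fun s : ℝ => u (fun i => ((s * ω i : ℝ) : ℂ)))
        (f (fun i => ((t * ω i : ℝ) : ℂ)) - fk 0) t) ∧
      -- `‖u‖_ρ ≤ γ⁻¹ ‖f‖_{2ρ} ϖ(τ,ρ)`
      (∀ M : ℝ, (∀ θ ∈ Strip d (2 * ρ), ‖f θ‖ ≤ M) →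
        ∀ θ ∈ Strip d ρ, ‖u θ‖ ≤ γ⁻¹ * M * varpi d τ ρ) := by
  have hτ0 : 0 < τ := by
    have : (1 : ℝ) ≤ d := by exact_mod_cast hd
    linarith
  have hρ2 : 0 ≤ 2 * ρ := by positivity
  let a : Fin n → (Fin d → ℤ) → ℂ := fun j k => fk k j / (Complex.I * (kdot k ω : ℝ))
  have ha0 : ∀ j, a j 0 = 0 := fun j => by simp [a, kdot_zero]
  have hsub : Strip d ρ ⊆ Strip d (2 * ρ) := fun θ hθ i => (hθ i).trans (by linarith)
  have hfs : ∀ j, Summable fun k => ‖fk k j‖ * Real.exp (2 * ρ * knorm k) := fun j =>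
    summable_norm_mul_exp_of_summable hρ2 fun θ hθ => (hfk θ hθ j).summable
  have hfs0 : ∀ j, Summable fun k => ‖fk k j‖ := fun j =>
    Summable.of_nonneg_of_le (fun _ => norm_nonneg _) (fun k =>
      le_mul_of_one_le_right (norm_nonneg _)
        (Real.one_le_exp (mul_nonneg hρ2 (knorm_nonneg k)))) (hfs j)
  have has : ∀ j, Summable fun k => ‖a j k‖ * Real.exp (3 / 2 * ρ * knorm k) := fun j => by
    refine Summable.of_nonneg_of_le (fun k => by positivity) (fun k => ?_)
      ((hfs j).mul_left (γ⁻¹ * (τ / (ρ / 2)) ^ τ))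
    calc ‖a j k‖ * Real.exp (3 / 2 * ρ * knorm k)
        ≤ (γ⁻¹ * ((τ / (ρ / 2)) ^ τ * Real.exp (ρ / 2 * knorm k)) * ‖fk k j‖) *
            Real.exp (3 / 2 * ρ * knorm k) := by
          gcongr
          refine (hdio.norm_div_le hγ k _).trans ?_
          gcongr
          exact rpow_le_mul_exp hτ0 (half_pos hρ) (knorm_nonneg k)
      _ = γ⁻¹ * (τ / (ρ / 2)) ^ τ *
            (‖fk k j‖ * (Real.exp (ρ / 2 * knorm k) * Real.exp (3 / 2 * ρ * knorm k))) := by ring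
      _ = _ := by rw [← Real.exp_add]; ring_nf
  have hau : ∀ j, ∀ θ ∈ Strip d ρ, Summable fun k => a j k * eK k θ := fun j θ hθ => by
    refine Summable.of_norm_bounded (has j) fun k => ?_
    rw [norm_mul]
    gcongr
    refine (norm_eK_le k hθ).trans (Real.exp_le_exp.2 ?_)
    gcongr
    · exact knorm_nonneg k
    · linarith
  have hconj : ∀ j k, (starRingEnd ℂ) (fk (-k) j) = fk k j := fun j =>
    conj_coeff_of_im_eq_zero (hfs0 j) fun x => by
      rw [(hfk _ (ofReal_mem_strip hρ2 x) j).tsum_eq]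
      exact hfreal x j
  refine ⟨fun θ j => ∑' k, a j k * eK k θ, ?_, ?_, ?_, ?_, ?_, ?_⟩
  · intro θ hθ j
    refine (hasSum_subtype_iff_of_support_subset (f := fun k => a j k * eK k θ)
      (s := {k | k ≠ 0}) ?_).2 (hau j θ hθ).hasSum
    intro k hk h0
    exact hk (by simp [h0, ha0])
  · intro θ m
    simp only [eK_add_two_pi]
  · intro θ hθ
    exact AnalyticAt.pi fun j =>
      analyticOnNhd_tsum_mul_eK (by linarith : ρ < 3 / 2 * ρ) (has j) θ hθ
  · intro x j
    rw [← Complex.conj_eq_iff_im, Complex.conj_tsum, ← (Equiv.neg (Fin d → ℤ)).tsum_eq]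
    refine tsum_congr fun k => ?_
    simp only [Equiv.neg_apply, map_mul, conj_eK_ofReal, neg_neg, a, map_div₀, hconj, kdot_neg,
      Complex.conj_I, Complex.conj_ofReal]
    simp
  · intro t
    rw [hasDerivAt_pi]
    intro j
    have hterm : ∀ k (s : ℝ), HasDerivAt
        (fun s : ℝ => a j k * eK k (fun i => ((s * ω i : ℝ) : ℂ)))
        (if k = 0 then 0 else fk k j * eK k (fun i => ((s * ω i : ℝ) : ℂ))) s := fun k s => by
      split_ifs with hk
      · simpa [hk, ha0] using hasDerivAt_const s (0 : ℂ)
      · simp only [eK_flow]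
        have h1 := ((Complex.ofRealCLM.hasDerivAt (x := s)).const_mul
          (Complex.I * (kdot k ω : ℝ))).cexp.const_mul (a j k)
        refine HasDerivAt.congr_deriv h1 ?_
        have : (kdot k ω : ℂ) ≠ 0 := Complex.ofReal_ne_zero.2 (hdio.kdot_ne_zero hγ hk)
        simp only [a, Complex.ofRealCLM_apply]
        field_simp
        simp
    have hnorm : ∀ k (s : ℝ), ‖eK k (fun i => ((s * ω i : ℝ) : ℂ))‖ = 1 := fun k s => by
      rw [norm_eK]; simp
    have hder := hasDerivAt_tsum (hfs0 j) hterm (fun k s => by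
      split_ifs
      · simp
      · rw [norm_mul, hnorm, mul_one])
      (hau j (fun i => ((t * ω i : ℝ) : ℂ)) (ofReal_mem_strip hρ.le _)) t
    have hval := (hfk (fun i => ((t * ω i : ℝ) : ℂ)) (ofReal_mem_strip hρ2 _) j).update 0 0
    have hval' : HasSum (fun k => if k = 0 then 0 else
        fk k j * eK k (fun i => ((t * ω i : ℝ) : ℂ)))
        (f (fun i => ((t * ω i : ℝ) : ℂ)) j - fk 0 j) := by
      have h0 : eK (0 : Fin d → ℤ) (fun i => ((t * ω i : ℝ) : ℂ)) = 1 := by simp [eK]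
      rw [h0, mul_one, zero_sub, neg_add_eq_sub] at hval
      exact hval.congr_fun fun k => by by_cases hk : k = 0 <;> simp [hk]
    rw [hval'.tsum_eq] at hder
    exact hder
  · intro M hM θ hθ
    have hM0 : 0 ≤ M := (norm_nonneg _).trans (hM θ (hsub hθ))
    have hvs := summable_exp_mul_knorm_rpow hτ0 hρ d
    have hv : varpi d τ ρ = ∑' k : Fin d → ℤ, Real.exp (-ρ * knorm k) * knorm k ^ τ :=
      tsum_subtype_eq_of_support_subset (s := {k : Fin d → ℤ | k ≠ 0})
        (f := fun k : Fin d → ℤ => Real.exp (-ρ * knorm k) * knorm k ^ τ) fun k hk h0 =>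
          hk (by simp [h0, knorm, Real.zero_rpow hτ0.ne'])
    have hbound : ∀ j k, ‖a j k * eK k θ‖ ≤
        γ⁻¹ * M * (Real.exp (-ρ * knorm k) * knorm k ^ τ) := fun j k => by
      have hk0 : 0 ≤ knorm k ^ τ := Real.rpow_nonneg (knorm_nonneg k) _
      have hcauchy := norm_coeff_mul_exp_le hρ2 (g := fun θ => f θ j) (fun θ hθ => hfk θ hθ j)
        (fun θ hθ => (norm_le_pi_norm (f θ) j).trans (hM θ hθ)) k
      calc ‖a j k * eK k θ‖ ≤ (γ⁻¹ * knorm k ^ τ * ‖fk k j‖) * Real.exp (ρ * knorm k) := by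
            rw [norm_mul]
            gcongr
            · exact hdio.norm_div_le hγ k _
            · exact norm_eK_le k hθ
        _ = γ⁻¹ * knorm k ^ τ * Real.exp (-ρ * knorm k) *
              (‖fk k j‖ * Real.exp (2 * ρ * knorm k)) := by
            have : Real.exp (ρ * knorm k) =
                Real.exp (-ρ * knorm k) * Real.exp (2 * ρ * knorm k) := by
              rw [← Real.exp_add]; ring_nf
            rw [this]; ring
        _ ≤ γ⁻¹ * knorm k ^ τ * Real.exp (-ρ * knorm k) * M := by gcongr
        _ = _ := by ring
    have hv0 : 0 ≤ varpi d τ ρ := hv ▸ tsum_nonneg fun k =>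
      mul_nonneg (Real.exp_pos _).le (Real.rpow_nonneg (knorm_nonneg k) _)
    refine (pi_norm_le_iff_of_nonneg (by positivity)).2 fun j => ?_
    rw [hv]
    exact tsum_of_norm_bounded (hvs.hasSum.mul_left _) (hbound j)

end
end

section
/- Let d ∈ ℕ₊, 0 < ν ≤ 1 and τ ≥ 1. Then Σ_{k ∈ ℤᵈ} e^{−ν|k|} |k|^τ ≤ (20d/(3ν^{d+τ})) · ((d+τ−1)/e)^{d+τ−1} · √(d+τ−1), where |k| = |k₁| + ⋯ + |k_d|. -/
open Filter Set

noncomputable section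

theorem hasSum_int_one_div_sq :
    HasSum (fun n : ℤ => (1 : ℝ) / (n : ℝ) ^ 2) (Real.pi ^ 2 / 3) := by
  have h := hasSum_zeta_two
  have h' : HasSum (fun n : ℕ => (1 : ℝ) / ((n + 1 : ℕ) : ℝ) ^ 2) (Real.pi ^ 2 / 6) := by
    simpa using (hasSum_nat_add_iff' (f := fun n : ℕ => (1 : ℝ) / (n : ℝ) ^ 2) 1).2 h
  have := HasSum.of_nat_of_neg_add_one (f := fun n : ℤ => (1 : ℝ) / (n : ℝ) ^ 2)
    (by simpa using h) (m' := Real.pi ^ 2 / 6) (by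
      convert h' using 2 with n
      push_cast
      ring)
  convert this using 1
  ring

open UpperHalfPlane in
/-- The Lipschitz summation formula bounds the series by its main term. -/
theorem pow_mul_tsum_pow_mul_exp_le {m : ℕ} (hm : 1 ≤ m) {ν : ℝ} (hν : 0 < ν) (hν1 : ν ≤ 1) :
    ν ^ (m + 1) * ∑' n : ℕ, (n : ℝ) ^ m * Real.exp (-ν * n) ≤ 13 / 12 * m.factorial := by
  set T := ∑' n : ℕ, (n : ℝ) ^ m * Real.exp (-ν * n) with hT
  have hπ := Real.pi_pos
  set y : ℝ := ν / (2 * Real.pi) with hy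
  have hy0 : 0 < y := by positivity
  have hT0 : 0 ≤ T := tsum_nonneg fun n => by positivity
  let z : ℍ := ⟨Complex.I * y, by simpa using hy0⟩
  have hz : (z : ℂ) = Complex.I * y := rfl
  have hid := EisensteinSeries.qExpansion_identity hm z
  have hq : ∑' n : ℕ, (n : ℂ) ^ m * Complex.exp (2 * Real.pi * Complex.I * z) ^ n = (T : ℂ) := by
    rw [hT, Complex.ofReal_tsum]
    refine tsum_congr fun n => ?_
    push_cast
    rw [← Complex.exp_nat_mul, hz, hy]
    congr 2
    have : (Real.pi : ℂ) ≠ 0 := by exact_mod_cast hπ.ne'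
    push_cast
    field_simp
    rw [Complex.I_sq]
    ring
  rw [hq] at hid
  have hb : ‖∑' n : ℤ, 1 / ((z : ℂ) + n) ^ (m + 1)‖ ≤ 1 / y ^ (m + 1) + Real.pi ^ 2 / 3 := by
    refine tsum_of_norm_bounded
      ((hasSum_ite_eq (0 : ℤ) (1 / y ^ (m + 1))).add hasSum_int_one_div_sq) fun n => ?_
    rw [norm_div, norm_one, norm_pow]
    by_cases hn : n = 0
    · subst hn
      simp [hz, abs_of_pos hy0]
    · have h1 : (1 : ℝ) ≤ |(n : ℝ)| := by exact_mod_cast Int.one_le_abs hn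
      have h2 : |(n : ℝ)| ≤ ‖(z : ℂ) + n‖ := by
        simpa [hz] using Complex.abs_re_le_norm ((z : ℂ) + n)
      simp only [hn, if_false, zero_add]
      apply one_div_le_one_div_of_le (by positivity)
      calc (n : ℝ) ^ 2 = |(n : ℝ)| ^ 2 := (sq_abs _).symm
        _ ≤ |(n : ℝ)| ^ (m + 1) := pow_le_pow_right₀ h1 (by lia)
        _ ≤ _ := by gcongr
  rw [hid] at hb
  have hn : ‖(-2 * Real.pi * Complex.I) ^ (m + 1) / (m.factorial : ℂ) * (T : ℂ)‖
      = (2 * Real.pi) ^ (m + 1) / m.factorial * T := by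
    simp [abs_of_nonneg hT0, abs_of_pos hπ]
  rw [hn] at hb
  have hf : (0 : ℝ) < m.factorial := by positivity
  have hyle : y ^ (m + 1) * (Real.pi ^ 2 / 3) ≤ 1 / 12 := by
    have h1 : y ≤ 1 / (2 * Real.pi) := by rw [hy]; gcongr
    have h2 : y ≤ 1 := h1.trans (by
      rw [div_le_one (by positivity)]; linarith [Real.pi_gt_three])
    calc y ^ (m + 1) * (Real.pi ^ 2 / 3) ≤ y ^ 2 * (Real.pi ^ 2 / 3) := by
          gcongr ?_ * _
          exact pow_le_pow_of_le_one hy0.le h2 (by lia)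
      _ ≤ (1 / (2 * Real.pi)) ^ 2 * (Real.pi ^ 2 / 3) := by gcongr
      _ = 1 / 12 := by field_simp; norm_num
  have hνy : ν ^ (m + 1) = y ^ (m + 1) * (2 * Real.pi) ^ (m + 1) := by
    rw [← mul_pow, hy]; congr 1; field_simp
  calc ν ^ (m + 1) * T
      = m.factorial * y ^ (m + 1) * ((2 * Real.pi) ^ (m + 1) / m.factorial * T) := by
        rw [hνy]; field_simp
    _ ≤ m.factorial * y ^ (m + 1) * (1 / y ^ (m + 1) + Real.pi ^ 2 / 3) := by gcongr
    _ = m.factorial * (1 + y ^ (m + 1) * (Real.pi ^ 2 / 3)) := by field_simp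
    _ ≤ m.factorial * (1 + 1 / 12) := by gcongr
    _ = _ := by ring

theorem factorial_le_exp_one_mul {m : ℕ} (hm : 1 ≤ m) :
    (m.factorial : ℝ) ≤ Real.exp 1 * (Real.sqrt m * (m / Real.exp 1) ^ m) := by
  obtain ⟨n, rfl⟩ : ∃ n, m = n + 1 := ⟨m - 1, by lia⟩
  have h := Stirling.stirlingSeq'_antitone (Nat.zero_le n)
  simp only [Function.comp, Nat.succ_eq_add_one, zero_add, Stirling.stirlingSeq_one] at h
  rw [Stirling.stirlingSeq, div_le_div_iff₀ (by positivity) (by positivity),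
    Real.sqrt_mul (by norm_num)] at h
  have h2 : (0 : ℝ) < √2 := by positivity
  refine le_of_mul_le_mul_right (h.trans_eq ?_) h2
  ring

theorem log_le_half_sub_inv {x : ℝ} (hx : 1 ≤ x) : Real.log x ≤ (x - x⁻¹) / 2 := by
  have h := Real.self_le_sinh_iff.2 (Real.log_nonneg hx)
  rwa [Real.sinh_log (by linarith)] at h

theorem log_interpolation {m t : ℝ} (hm : 1 ≤ m) (ht : 0 ≤ t) (ht1 : t ≤ 1) :
    (1 - t) * ((m + 1 / 2) * Real.log m) + t * ((m + 1 + 1 / 2) * Real.log (m + 1))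
      ≤ (m + t + 1 / 2) * Real.log (m + t) + 1 / 10 := by
  have hm0 : 0 < m := by linarith
  have hs : 0 < m + t := by linarith
  have h1 : 2 * t / (2 * m + t) ≤ Real.log (m + t) - Real.log m := by
    have := Real.le_log_one_add_of_nonneg (x := t / m) (by positivity)
    rw [← Real.log_div hs.ne' (by linarith)]
    rw [show (m + t) / m = 1 + t / m by field_simp]
    refine le_trans (le_of_eq ?_) this
    field_simp
    ring
  have h2 : Real.log (m + 1) - Real.log (m + t)
      ≤ (1 - t) * (2 * m + 1 + t) / (2 * (m + t) * (m + 1)) := by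
    have := log_le_half_sub_inv (x := (m + 1) / (m + t)) (by rw [one_le_div hs]; linarith)
    rw [← Real.log_div (by linarith) hs.ne']
    refine this.trans_eq ?_
    field_simp
    ring
  have hb : (m + 3 / 2) * (2 * m + 1 + t) / (2 * (m + t) * (m + 1)) - (2 * m + 1) / (2 * m + t)
      ≤ 2 / 5 := by
    obtain ⟨u, rfl⟩ : ∃ u, m = 1 + u := ⟨m - 1, by ring⟩
    have hu : 0 ≤ u := by linarith
    rw [div_sub_div _ _ (by positivity) (by positivity), div_le_div_iff₀ (by positivity) (by positivity)]
    have := mul_nonneg hu ht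
    have := mul_nonneg hu (sub_nonneg.2 ht1)
    have := mul_nonneg ht (sub_nonneg.2 ht1)
    have := mul_nonneg this hu
    have := mul_nonneg this hu
    have := mul_nonneg (mul_nonneg hu hu) ht
    nlinarith [pow_nonneg hu 3, pow_nonneg hu 2, mul_nonneg (mul_nonneg hu hu) (sub_nonneg.2 ht1)]
  have k1 := mul_le_mul_of_nonneg_left h1 (show 0 ≤ (1 - t) * (m + 1 / 2) from
    mul_nonneg (by linarith) (by linarith))
  have k2 := mul_le_mul_of_nonneg_left h2 (show 0 ≤ t * (m + 3 / 2) from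
    mul_nonneg (by linarith) (by linarith))
  have k3 := mul_le_mul_of_nonneg_left hb (show 0 ≤ t * (1 - t) from
    mul_nonneg (by linarith) (by linarith))
  have k4 : t * (1 - t) * ((m + 3 / 2) * (2 * m + 1 + t) / (2 * (m + t) * (m + 1))
      - (2 * m + 1) / (2 * m + t))
      = t * (m + 3 / 2) * ((1 - t) * (2 * m + 1 + t) / (2 * (m + t) * (m + 1)))
        - (1 - t) * (m + 1 / 2) * (2 * t / (2 * m + t)) := by
    field_simp
  nlinarith [sq_nonneg (t - 1 / 2)]

theorem exp_eq_sqrt_mul_rpow_div {x ν : ℝ} (hx : 0 < x) (hν : 0 < ν) :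
    Real.exp ((x + 1 / 2) * Real.log x - x - (x + 1) * Real.log ν)
      = Real.sqrt x * (x / Real.exp 1) ^ x / ν ^ (x + 1) := by
  rw [Real.sqrt_eq_rpow, Real.rpow_def_of_pos hx, Real.rpow_def_of_pos (by positivity),
    Real.rpow_def_of_pos hν, Real.log_div hx.ne' (Real.exp_pos 1).ne', Real.log_exp,
    ← Real.exp_add, ← Real.exp_sub]
  congr 1
  ring

theorem rpow_add_le_interpolation {x c t : ℝ} {m : ℕ} (hm : 1 ≤ m) (hx : 0 ≤ x)
    (ht : 0 ≤ t) (ht1 : t ≤ 1) :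
    x ^ ((m : ℝ) + t)
      ≤ Real.exp (t * c) * ((1 - t) * x ^ m + t * (Real.exp (-c) * x ^ (m + 1))) := by
  have hm' : (1 : ℝ) ≤ m := by exact_mod_cast hm
  have h1 : 0 ≤ 1 - t := by linarith
  rcases hx.eq_or_lt with rfl | hx
  · rw [Real.zero_rpow (by linarith)]
    positivity
  have := Real.geom_mean_le_arith_mean2_weighted h1 ht (pow_nonneg hx.le m)
    (show 0 ≤ Real.exp (-c) * x ^ (m + 1) by positivity) (by ring)
  refine le_trans (le_of_eq ?_) (mul_le_mul_of_nonneg_left this (Real.exp_pos _).le)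
  rw [Real.mul_rpow (by positivity) (by positivity), ← Real.exp_mul, ← Real.rpow_natCast,
    ← Real.rpow_natCast, ← Real.rpow_mul hx.le, ← Real.rpow_mul hx.le]
  calc x ^ ((m : ℝ) + t)
      = (Real.exp (t * c) * Real.exp (-c * t))
          * (x ^ ((m : ℝ) * (1 - t)) * x ^ (((m + 1 : ℕ) : ℝ) * t)) := by
        rw [← Real.exp_add, ← Real.rpow_add hx, show t * c + -c * t = 0 by ring, Real.exp_zero,
          one_mul]
        push_cast
        ring_nf
    _ = _ := by ring

theorem tsum_pow_mul_exp_le {m : ℕ} (hm : 1 ≤ m) {ν : ℝ} (hν : 0 < ν) (hν1 : ν ≤ 1) :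
    ∑' n : ℕ, (n : ℝ) ^ m * Real.exp (-ν * n)
      ≤ 13 / 12 * Real.exp 1
        * Real.exp (((m : ℝ) + 1 / 2) * Real.log m - m - (m + 1) * Real.log ν) := by
  have hm' : (0 : ℝ) < m := by exact_mod_cast hm
  have h := (pow_mul_tsum_pow_mul_exp_le hm hν hν1).trans
    (mul_le_mul_of_nonneg_left (factorial_le_exp_one_mul hm) (by norm_num))
  rw [exp_eq_sqrt_mul_rpow_div hm' hν, ← mul_div_assoc, le_div_iff₀ (by positivity)]
  norm_cast
  norm_cast at h
  linarith

theorem tsum_rpow_mul_exp_le {s ν : ℝ} (hs : 1 ≤ s) (hν : 0 < ν) (hν1 : ν ≤ 1) :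
    Summable (fun n : ℕ => (n : ℝ) ^ s * Real.exp (-ν * n)) ∧
    ∑' n : ℕ, (n : ℝ) ^ s * Real.exp (-ν * n)
      ≤ 10 / 3 * (Real.sqrt s * (s / Real.exp 1) ^ s / ν ^ (s + 1)) := by
  obtain ⟨m, t, hm, ht, ht1, rfl⟩ : ∃ (m : ℕ) (t : ℝ), 1 ≤ m ∧ 0 ≤ t ∧ t ≤ 1 ∧ s = m + t :=
    ⟨⌊s⌋₊, s - ⌊s⌋₊, (Nat.one_le_floor_iff s).2 hs,
      sub_nonneg.2 (Nat.floor_le (by linarith)), by linarith [Nat.lt_floor_add_one s], by ring⟩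
  have hm' : (1 : ℝ) ≤ m := by exact_mod_cast hm
  set L : ℝ → ℝ := fun x => (x + 1 / 2) * Real.log x - x - (x + 1) * Real.log ν with hL
  set c := L (m + 1) - L m with hc
  have hbound (n : ℕ) : (n : ℝ) ^ ((m : ℝ) + t) * Real.exp (-ν * n)
      ≤ Real.exp (t * c) * ((1 - t) * ((n : ℝ) ^ m * Real.exp (-ν * n))
        + t * Real.exp (-c) * ((n : ℝ) ^ (m + 1) * Real.exp (-ν * n))) :=
    (mul_le_mul_of_nonneg_right (rpow_add_le_interpolation (c := c) hm n.cast_nonneg ht ht1)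
      (Real.exp_pos _).le).trans_eq (by ring)
  have hs0 := Real.summable_pow_mul_exp_neg_nat_mul m hν
  have hs1 := Real.summable_pow_mul_exp_neg_nat_mul (m + 1) hν
  have hsb := ((hs0.mul_left (1 - t)).add (hs1.mul_left (t * Real.exp (-c)))).mul_left
    (Real.exp (t * c))
  have hsum := Summable.of_nonneg_of_le (fun n => by positivity) hbound hsb
  refine ⟨hsum, ?_⟩
  rw [← exp_eq_sqrt_mul_rpow_div (by linarith) hν]
  have hT0 := tsum_pow_mul_exp_le hm hν hν1
  have hT1 := tsum_pow_mul_exp_le (m := m + 1) (by lia) hν hν1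
  push_cast at hT1
  have hconst : 13 / 12 * Real.exp 1 * Real.exp (1 / 10) ≤ 10 / 3 := by
    have h1 := Real.exp_one_lt_d9
    have h2 : Real.exp (1 / 10) ≤ 10 / 9 := by
      have := Real.add_one_le_exp (-(1 / 10 : ℝ))
      rw [Real.exp_neg] at this
      have := inv_anti₀ (by norm_num) this
      norm_num at this ⊢
      exact this
    nlinarith [Real.exp_pos 1, Real.exp_pos (1 / 10)]
  have hconv : (1 - t) * L m + t * L (m + 1) ≤ L (m + t) + 1 / 10 := by
    have := log_interpolation hm' ht ht1
    simp only [hL]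
    linarith
  have h1t : 0 ≤ 1 - t := by linarith
  calc ∑' n : ℕ, (n : ℝ) ^ ((m : ℝ) + t) * Real.exp (-ν * n)
      ≤ Real.exp (t * c) * ((1 - t) * ∑' n : ℕ, (n : ℝ) ^ m * Real.exp (-ν * n)
        + t * Real.exp (-c) * ∑' n : ℕ, (n : ℝ) ^ (m + 1) * Real.exp (-ν * n)) := by
        refine (hsum.tsum_le_tsum hbound hsb).trans_eq ?_
        rw [tsum_mul_left, (hs0.mul_left _).tsum_add (hs1.mul_left _), tsum_mul_left, tsum_mul_left]
    _ ≤ Real.exp (t * c) * ((1 - t) * (13 / 12 * Real.exp 1 * Real.exp (L m))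
        + t * Real.exp (-c) * (13 / 12 * Real.exp 1 * Real.exp (L (m + 1)))) := by
        gcongr
    _ = 13 / 12 * Real.exp 1 * Real.exp ((1 - t) * L m + t * L (m + 1)) := by
        have h1 : Real.exp (L (m + 1)) = Real.exp c * Real.exp (L m) := by
          rw [← Real.exp_add, hc]; ring_nf
        have h2 : Real.exp (-c) * Real.exp c = 1 := by rw [← Real.exp_add]; simp
        have h3 : Real.exp ((1 - t) * L m + t * L (m + 1)) = Real.exp (t * c) * Real.exp (L m) := by
          rw [← Real.exp_add, hc]; ring_nf
        rw [h1, h3]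
        linear_combination (Real.exp (t * c) * t * (13 / 12 * Real.exp 1) * Real.exp (L m)) * h2
    _ ≤ 13 / 12 * Real.exp 1 * Real.exp (L (m + t) + 1 / 10) := by gcongr
    _ = 13 / 12 * Real.exp 1 * Real.exp (1 / 10) * Real.exp (L (m + t)) := by
        rw [Real.exp_add]; ring
    _ ≤ 10 / 3 * Real.exp (L (m + t)) := by gcongr

/-- The number of integer vectors in dimension `d` with ℓ¹ norm `n`. -/
def sphereCount : ℕ → ℕ → ℕ
  | 0, n => if n = 0 then 1 else 0
  | d + 1, n => sphereCount d n + 2 * ∑ i ∈ Finset.range n, sphereCount d i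

theorem sphereCount_zero_right (d : ℕ) : sphereCount d 0 = 1 := by
  induction d with
  | zero => simp [sphereCount]
  | succ d ih => simp [sphereCount, ih]

theorem succ_mul_sum_range_pow_le (d n : ℕ) :
    (d + 1) * ∑ i ∈ Finset.range n, (i + 1) ^ d + 1 ≤ (n + 1) ^ (d + 1) := by
  induction n with
  | zero => simp
  | succ n ih =>
    rw [Finset.sum_range_succ, mul_add]
    have h : (n + 1) ^ (d + 1) + (d + 1) * (n + 1) ^ d ≤ (n + 1 + 1) ^ (d + 1) := by
      clear ih
      induction d with
      | zero => simp
      | succ d ih =>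
        calc (n + 1) ^ (d + 1 + 1) + (d + 1 + 1) * (n + 1) ^ (d + 1)
            ≤ ((n + 1) ^ (d + 1) + (d + 1) * (n + 1) ^ d) * (n + 1 + 1) := by
              have : 0 ≤ (d + 1) * (n + 1) ^ d := by positivity
              ring_nf
              ring_nf at this
              nlinarith
          _ ≤ (n + 1 + 1) ^ (d + 1) * (n + 1 + 1) := by gcongr
          _ = _ := by ring
    lia

theorem sphereCount_le (d n : ℕ) :
    sphereCount (d + 1) (n + 1) ≤ 2 * (d + 1) * (n + 1) ^ d := by
  induction d generalizing n with
  | zero => simp [sphereCount]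
  | succ d ih =>
    rw [sphereCount, Finset.sum_range_succ', sphereCount_zero_right]
    have h1 : ∑ i ∈ Finset.range n, sphereCount (d + 1) (i + 1)
        ≤ 2 * ((d + 1) * ∑ i ∈ Finset.range n, (i + 1) ^ d) := by
      rw [Finset.mul_sum, Finset.mul_sum]
      exact Finset.sum_le_sum fun i _ => (ih i).trans_eq (by ring)
    have h2 := succ_mul_sum_range_pow_le d n
    have h3 := ih n
    have h4 : (d + 1) * (n + 1) ^ d ≤ d * (n + 1) ^ (d + 1) + 1 := by
      rcases Nat.eq_zero_or_pos d with rfl | hd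
      · simp
      rcases Nat.eq_zero_or_pos n with rfl | hn
      · simp
      rw [pow_succ]
      have : (d + 1) ≤ d * (n + 1) := by nlinarith
      calc (d + 1) * (n + 1) ^ d ≤ d * (n + 1) * (n + 1) ^ d := by gcongr
        _ ≤ _ := by lia
    calc _ ≤ 2 * ((d + 1) * (n + 1) ^ d) + 2 * (2 * ((n + 1) ^ (d + 1) - 1) + 1) := by lia
      _ ≤ _ := by
        have : 1 ≤ (n + 1) ^ (d + 1) := Nat.one_le_pow _ _ (by lia)
        have : 2 * (d + 1 + 1) * (n + 1) ^ (d + 1) = 2 * (d * (n + 1) ^ (d + 1))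
          + 4 * (n + 1) ^ (d + 1) := by ring
        lia

open scoped ENNReal

theorem tsum_int_natAbs (G : ℕ → ℝ≥0∞) :
    ∑' j : ℤ, G j.natAbs = G 0 + 2 * ∑' j : ℕ, G (j + 1) := by
  rw [tsum_of_nat_of_neg_add_one ENNReal.summable ENNReal.summable]
  have h (n : ℕ) : (-((n : ℤ) + 1)).natAbs = n + 1 := by lia
  simp only [h, Int.natAbs_natCast]
  rw [tsum_eq_zero_add' ENNReal.summable, two_mul, add_assoc]

theorem tsum_sum_natAbs (d : ℕ) (F : ℕ → ℝ≥0∞) :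
    ∑' k : Fin d → ℤ, F (∑ i, (k i).natAbs) = ∑' n : ℕ, (sphereCount d n : ℝ≥0∞) * F n := by
  induction d generalizing F with
  | zero =>
    rw [tsum_eq_single (0 : ℕ) (by simp +contextual [sphereCount])]
    simp [sphereCount]
  | succ d ih =>
    rw [← (Fin.consEquiv fun _ => ℤ).tsum_eq, ENNReal.tsum_prod']
    simp only [Fin.consEquiv, Equiv.coe_fn_mk, Fin.sum_univ_succ, Fin.cons_zero, Fin.cons_succ]
    have hshift (n : ℕ) : ∑' j : ℕ, F (j + 1 + n) = ∑' N : ℕ, if n < N then F N else 0 := by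
      rw [← (ENNReal.summable.sum_add_tsum_nat_add' (f := fun N => if n < N then F N else 0)
        (k := n + 1)), Finset.sum_eq_zero, zero_add]
      · refine tsum_congr fun j => ?_
        rw [if_pos (by lia)]
        congr 1
        lia
      · intro i hi
        rw [if_neg]
        simp at hi
        lia
    calc ∑' (j : ℤ) (k : Fin d → ℤ), F (j.natAbs + ∑ i, (k i).natAbs)
        = ∑' (j : ℤ) (n : ℕ), (sphereCount d n : ℝ≥0∞) * F (j.natAbs + n) :=
          tsum_congr fun j => ih fun n => F (j.natAbs + n)
      _ = ∑' n : ℕ, (sphereCount d n : ℝ≥0∞) * (F n + 2 * ∑' j : ℕ, F (j + 1 + n)) := by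
          rw [ENNReal.tsum_comm]
          refine tsum_congr fun n => ?_
          rw [ENNReal.tsum_mul_left, tsum_int_natAbs fun j => F (j + n), zero_add]
      _ = ∑' n : ℕ, (sphereCount d n : ℝ≥0∞) * F n
          + 2 * ∑' (n : ℕ) (N : ℕ), if n < N then (sphereCount d n : ℝ≥0∞) * F N else 0 := by
          rw [← ENNReal.tsum_mul_left, ← ENNReal.tsum_add]
          refine tsum_congr fun n => ?_
          rw [hshift, mul_add, mul_left_comm, ← ENNReal.tsum_mul_left]
          simp only [mul_ite, mul_zero]
      _ = _ := by
          rw [ENNReal.tsum_comm, ← ENNReal.tsum_mul_left, ← ENNReal.tsum_add]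
          refine tsum_congr fun N => ?_
          have h : ∑' n : ℕ, (if n < N then (sphereCount d n : ℝ≥0∞) * F N else 0)
              = (∑ n ∈ Finset.range N, (sphereCount d n : ℝ≥0∞)) * F N := by
            rw [tsum_eq_sum (s := Finset.range N) (by simp +contextual), Finset.sum_mul]
            exact Finset.sum_congr rfl fun n hn => if_pos (Finset.mem_range.1 hn)
          rw [h, sphereCount]
          push_cast
          ring

theorem knorm_eq_natCast {d : ℕ} (k : Fin d → ℤ) :
    knorm k = ((∑ i, (k i).natAbs : ℕ) : ℝ) := by
  simp [knorm, Nat.cast_natAbs]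

theorem tsum_knorm_le {d : ℕ} {g : ℕ → ℝ} (hg : ∀ n, 0 ≤ g n) (hg0 : g 0 = 0)
    (hs : Summable fun n : ℕ => (n : ℝ) ^ d * g n) :
    Summable (fun k : Fin (d + 1) → ℤ => g (∑ i, (k i).natAbs)) ∧
    ∑' k : Fin (d + 1) → ℤ, g (∑ i, (k i).natAbs)
      ≤ 2 * (d + 1) * ∑' n : ℕ, (n : ℝ) ^ d * g n := by
  have hle : ∑' k : Fin (d + 1) → ℤ, ENNReal.ofReal (g (∑ i, (k i).natAbs))
      ≤ ENNReal.ofReal (2 * (d + 1) * ∑' n : ℕ, (n : ℝ) ^ d * g n) := by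
    rw [tsum_sum_natAbs (d + 1) fun n => ENNReal.ofReal (g n), ← tsum_mul_left,
      ENNReal.ofReal_tsum_of_nonneg (fun n => by have := hg n; positivity) (hs.mul_left _)]
    refine ENNReal.tsum_le_tsum fun n => ?_
    rcases n with _ | n
    · simp [hg0]
    rw [← ENNReal.ofReal_natCast, ← ENNReal.ofReal_mul (Nat.cast_nonneg _), ← mul_assoc]
    refine ENNReal.ofReal_le_ofReal (mul_le_mul_of_nonneg_right ?_ (hg _))
    exact_mod_cast sphereCount_le d n
  have hsum : Summable (fun k : Fin (d + 1) → ℤ => g (∑ i, (k i).natAbs)) := by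
    have := ENNReal.summable_toReal (ne_top_of_le_ne_top ENNReal.ofReal_ne_top hle)
    simpa only [ENNReal.toReal_ofReal (hg _)] using this
  refine ⟨hsum, ?_⟩
  rw [← ENNReal.ofReal_tsum_of_nonneg (fun k => hg _) hsum] at hle
  exact (ENNReal.ofReal_le_ofReal_iff (mul_nonneg (by positivity)
    (tsum_nonneg fun n => mul_nonneg (by positivity) (hg n)))).1 hle

/-- **Lemma A.2** (Jorba–Simó).  For `0 < ν ≤ 1` and `τ ≥ 1`,
`Σ_{k ∈ ℤᵈ} e^{-ν|k|}|k|^τ ≤ (20d/(3ν^{d+τ})) ((d+τ-1)/e)^{d+τ-1} √(d+τ-1)`. -/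
theorem exponential_sum_bound
    (d : ℕ) (hd : 0 < d) (ν τ : ℝ) (hν : 0 < ν) (hν1 : ν ≤ 1) (hτ : 1 ≤ τ) :
    Summable (fun k : Fin d → ℤ => Real.exp (-ν * knorm k) * knorm k ^ τ) ∧
    ∑' k : Fin d → ℤ, Real.exp (-ν * knorm k) * knorm k ^ τ
      ≤ 20 * d / (3 * ν ^ ((d : ℝ) + τ))
        * (((d : ℝ) + τ - 1) / Real.exp 1) ^ ((d : ℝ) + τ - 1)
        * Real.sqrt ((d : ℝ) + τ - 1) := by
  obtain ⟨d, rfl⟩ : ∃ D, d = D + 1 := ⟨d - 1, by lia⟩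
  set s : ℝ := d + τ with hs
  have hs1 : 1 ≤ s := hτ.trans (le_add_of_nonneg_left d.cast_nonneg)
  obtain ⟨hsum, hle⟩ := tsum_rpow_mul_exp_le hs1 hν hν1
  have hterm (n : ℕ) : (n : ℝ) ^ d * (Real.exp (-ν * n) * (n : ℝ) ^ τ)
      = (n : ℝ) ^ s * Real.exp (-ν * n) := by
    rw [hs, Real.rpow_add_of_nonneg n.cast_nonneg d.cast_nonneg (by linarith), Real.rpow_natCast]
    ring
  obtain ⟨h1, h2⟩ := tsum_knorm_le (d := d) (g := fun n => Real.exp (-ν * n) * (n : ℝ) ^ τ)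
    (fun n => by positivity) (by simp [Real.zero_rpow (by linarith : τ ≠ 0)])
    (hsum.congr fun n => (hterm n).symm)
  simp only [hterm] at h2
  simp only [knorm_eq_natCast]
  refine ⟨h1, h2.trans ?_⟩
  have e1 : ((d + 1 : ℕ) : ℝ) + τ = s + 1 := by rw [hs]; push_cast; ring
  rw [e1, add_sub_cancel_right]
  calc 2 * ((d : ℝ) + 1) * ∑' n : ℕ, (n : ℝ) ^ s * Real.exp (-ν * n)
      ≤ 2 * ((d : ℝ) + 1) * (10 / 3 * (Real.sqrt s * (s / Real.exp 1) ^ s / ν ^ (s + 1))) := by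
        gcongr
    _ = _ := by
        push_cast
        field_simp
        norm_num

end
end
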